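/- Let n ≥ 1, 0 < s < 1, 1 ≤ p < ∞, and let F be a finite-dimensional real inner product space. There exists a constant C = C(n,s,p) > 0 such that for every connection form Γ ∈ C¹ on the closed half-space ℝⁿ × [0,∞) ⊆ ℝ^{n+1} with values in L(ℝ^{n+1}, o(F)) and every C¹ map U : ℝⁿ × [0,∞) → F with compact support: ∫_{ℝⁿ} ‖U(x,0)‖^p dx ≤ C (∫_{ℝⁿ×(0,∞)} ‖D_Γ U(z)‖^p / z_{n+1}^{1−(1−s)p} dz)^{1−s} · (∫_{ℝⁿ×(0,∞)} ‖U(z)‖^p / z_{n+1}^{1−(1−s)p} dz)^{s}, where z = (z', z_{n+1}) and ‖D_Γ U(z)‖ is the Hilbert–Schmidt norm of D_Γ U(z) ∈ L(ℝ^{n+1}, F). -/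

import Mathlib

set_option synthInstance.maxHeartbeats 1000000
set_option maxHeartbeats 1000000

open Set MeasureTheory
open scoped RealInnerProductSpace ENNReal

/-- The point `(x, t) ∈ ℝⁿ × ℝ ≅ ℝ^{n+1}`. -/
noncomputable def emb {n : ℕ} (x : EuclideanSpace ℝ (Fin n)) (t : ℝ) :
    EuclideanSpace ℝ (Fin (n + 1)) :=
  (EuclideanSpace.equiv (Fin (n + 1)) ℝ).symm
    (Fin.snoc ((EuclideanSpace.equiv (Fin n) ℝ) x) t)

/-- The Hilbert–Schmidt (Frobenius) norm of a continuous linear map from `ℝ^m` to `F`. -/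
noncomputable def hsNorm {m : ℕ} {F : Type*} [NormedAddCommGroup F] [InnerProductSpace ℝ F]
    (T : EuclideanSpace ℝ (Fin m) →L[ℝ] F) : ℝ :=
  Real.sqrt (∑ i : Fin m, ‖T (EuclideanSpace.single i (1 : ℝ))‖ ^ 2)

/-- The closed upper half-space `ℝⁿ × [0,∞) ⊆ ℝ^{n+1}`. -/
def closedHalfSpace (n : ℕ) : Set (EuclideanSpace ℝ (Fin (n + 1))) :=
  {z | 0 ≤ z (Fin.last n)}

lemma aux_weight (b t : ℝ) (hb : 0 < b) (ht : 0 < t) :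
    ∫⁻ r in Ioc (0:ℝ) t, ENNReal.ofReal (r ^ (b - 1)) = ENNReal.ofReal (t ^ b / b) := by
  have hi : IntervalIntegrable (fun r : ℝ => r ^ (b - 1)) volume 0 t :=
    intervalIntegral.intervalIntegrable_rpow' (by linarith)
  rw [← ofReal_integral_eq_lintegral_ofReal]
  · rw [← intervalIntegral.integral_of_le ht.le, integral_rpow (Or.inl (by linarith))]
    rw [sub_add_cancel, Real.zero_rpow hb.ne', sub_zero]
  · exact (intervalIntegrable_iff_integrableOn_Ioc_of_le ht.le).1 hi
  · filter_upwards [ae_restrict_mem measurableSet_Ioc] with r hr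
    exact Real.rpow_nonneg hr.1.le _

lemma aux_jensen (s p t : ℝ) (hs0 : 0 < s) (hp : 1 ≤ p) (ht : 0 < t)
    (g : ℝ → ℝ) (hg0 : ∀ r, 0 ≤ g r)
    (hg : AEMeasurable g (volume.restrict (Ioc 0 t))) :
    (∫⁻ r in Ioc 0 t, ENNReal.ofReal (g r)) ^ p ≤
      ENNReal.ofReal (s ^ (1 - p) * t ^ (s * p)) *
        ∫⁻ r in Ioc (0:ℝ) t, ENNReal.ofReal (g r ^ p / r ^ (1 - (1 - s) * p)) := by
  have hp0 : 0 < p := by linarith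
  let w : ℝ → ℝ≥0∞ := fun r => ENNReal.ofReal (r ^ (s - 1))
  have hw : Measurable w := by fun_prop
  let μ : Measure ℝ := (volume.restrict (Ioc 0 t)).withDensity w
  let h : ℝ → ℝ := fun r => g r * r ^ (1 - s)
  have hh : AEMeasurable h (volume.restrict (Ioc 0 t)) := by
    refine hg.mul ?_
    fun_prop
  have hhμ : AEMeasurable h μ := hh.mono_ac (withDensity_absolutelyContinuous _ _)
  have key := eLpNorm'_le_eLpNorm'_mul_rpow_measure_univ (μ := μ) (f := h) one_pos hp
    hhμ.aestronglyMeasurable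
  have hμ : μ univ = ENNReal.ofReal (t ^ s / s) := by
    rw [withDensity_apply _ MeasurableSet.univ, Measure.restrict_univ]
    exact aux_weight s t hs0 ht
  have h1 : eLpNorm' h 1 μ = ∫⁻ r in Ioc 0 t, ENNReal.ofReal (g r) := by
    simp only [eLpNorm', ENNReal.rpow_one, div_one]
    rw [lintegral_withDensity_eq_lintegral_mul₀ hw.aemeasurable hh.enorm]
    refine setLIntegral_congr_fun measurableSet_Ioc fun r hr => ?_
    have hr0 : 0 < r := hr.1
    simp only [Pi.mul_apply, w, h]
    rw [Real.enorm_eq_ofReal (mul_nonneg (hg0 r) (Real.rpow_nonneg hr0.le _)),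
      ← ENNReal.ofReal_mul (Real.rpow_nonneg hr0.le _)]
    congr 1
    rw [mul_comm, mul_assoc, ← Real.rpow_add hr0]; simp
  have h2 : ∫⁻ r, ‖h r‖ₑ ^ p ∂μ ≤ ENNReal.ofReal (t ^ s) *
      ∫⁻ r in Ioc (0:ℝ) t, ENNReal.ofReal (g r ^ p / r ^ (1 - (1 - s) * p)) := by
    rw [lintegral_withDensity_eq_lintegral_mul₀ hw.aemeasurable (hh.enorm.pow_const p),
      ← lintegral_const_mul' _ _ ENNReal.ofReal_ne_top]
    refine setLIntegral_mono' measurableSet_Ioc fun r hr => ?_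
    have hr0 : 0 < r := hr.1
    simp only [Pi.mul_apply, w, h]
    rw [Real.enorm_eq_ofReal (mul_nonneg (hg0 r) (Real.rpow_nonneg hr0.le _)),
      ENNReal.ofReal_rpow_of_nonneg (mul_nonneg (hg0 r) (Real.rpow_nonneg hr0.le _)) hp0.le,
      ← ENNReal.ofReal_mul (Real.rpow_nonneg hr0.le _),
      ← ENNReal.ofReal_mul (Real.rpow_nonneg ht.le _)]
    apply ENNReal.ofReal_le_ofReal
    rw [Real.mul_rpow (hg0 r) (Real.rpow_nonneg hr0.le _), ← Real.rpow_mul hr0.le,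
      div_eq_mul_inv, ← Real.rpow_neg hr0.le]
    have e : r ^ (s - 1) * (g r ^ p * r ^ ((1 - s) * p))
        = r ^ s * (g r ^ p * r ^ (-(1 - (1 - s) * p))) := by
      have : r ^ (s - 1) * r ^ ((1 - s) * p) = r ^ s * r ^ (-(1 - (1 - s) * p)) := by
        rw [← Real.rpow_add hr0, ← Real.rpow_add hr0]; congr 1; ring
      linear_combination (g r ^ p) * this
    rw [e]
    have := Real.rpow_nonneg (hg0 r) p
    have := Real.rpow_nonneg hr0.le (-(1 - (1 - s) * p))
    gcongr
    exact hr.2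
  rw [h1, hμ] at key
  calc _ ≤ (eLpNorm' h p μ * ENNReal.ofReal (t ^ s / s) ^ (1 / 1 - 1 / p)) ^ p := by gcongr
    _ = (∫⁻ r, ‖h r‖ₑ ^ p ∂μ) * ENNReal.ofReal (t ^ s / s) ^ (p - 1) := by
      rw [ENNReal.mul_rpow_of_nonneg _ _ hp0.le, eLpNorm', ← ENNReal.rpow_mul,
        ← ENNReal.rpow_mul]
      congr 2
      · rw [one_div, inv_mul_cancel₀ hp0.ne', ENNReal.rpow_one]
      · field_simp
    _ ≤ (ENNReal.ofReal (t ^ s) *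
      ∫⁻ r in Ioc (0:ℝ) t, ENNReal.ofReal (g r ^ p / r ^ (1 - (1 - s) * p))) *
        ENNReal.ofReal (t ^ s / s) ^ (p - 1) := by gcongr
    _ = (ENNReal.ofReal (t ^ s) * ENNReal.ofReal (t ^ s / s) ^ (p - 1)) *
      ∫⁻ r in Ioc (0:ℝ) t, ENNReal.ofReal (g r ^ p / r ^ (1 - (1 - s) * p)) := by ring
    _ = _ := by
      congr 1
      rw [ENNReal.ofReal_rpow_of_nonneg (by positivity) (by linarith),
        ← ENNReal.ofReal_mul (by positivity)]
      congr 1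
      rw [Real.div_rpow (by positivity) hs0.le, ← Real.rpow_mul ht.le, mul_div_assoc',
        ← Real.rpow_add ht, div_eq_mul_inv, ← Real.rpow_neg hs0.le, mul_comm]
      congr 2 <;> ring

/-- diamagnetic inequality in one dimension -/
lemma aux_diamag {F : Type*} [NormedAddCommGroup F] [InnerProductSpace ℝ F]
    (u u' v : ℝ → F) (t : ℝ) (ht : 0 < t)
    (hu : ∀ r, 0 ≤ r → HasDerivWithinAt u (u' r) (Ici 0) r)
    (hv : ContinuousOn v (Ici 0))
    (hin : ∀ r, 0 ≤ r → ⟪u r, u' r⟫ = ⟪u r, v r⟫) :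
    ‖u 0‖ ≤ ‖u t‖ + ∫ r in (0:ℝ)..t, ‖v r‖ := by
  have hint : IntegrableOn (fun r => ‖v r‖) (Icc 0 t) :=
    ((hv.mono Icc_subset_Ici_self).norm).integrableOn_Icc
  have main : ∀ ε : ℝ, 0 < ε → ‖u 0‖ ≤ ‖u t‖ + ε + ∫ r in (0:ℝ)..t, ‖v r‖ := by
    intro ε hε
    let φ : ℝ → ℝ := fun r => - Real.sqrt (⟪u r, u r⟫ + ε ^ 2)
    have hpos : ∀ r, 0 < ⟪u r, u r⟫ + ε ^ 2 := fun r => by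
      have : 0 ≤ ⟪u r, u r⟫ := real_inner_self_nonneg
      positivity
    have hφ : ∀ r, 0 ≤ r → HasDerivWithinAt φ
        (-((⟪u r, u' r⟫ + ⟪u' r, u r⟫) / (2 * Real.sqrt (⟪u r, u r⟫ + ε ^ 2)))) (Ici 0) r := by
      intro r hr
      exact ((((hu r hr).inner ℝ (hu r hr)).add_const _).sqrt (hpos r).ne').neg
    have := intervalIntegral.sub_le_integral_of_hasDeriv_right_of_le ht.le
      (g := φ) (φ := fun r => ‖v r‖)
      (fun r hr => ((hφ r hr.1).continuousWithinAt).mono Icc_subset_Ici_self)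
      (fun r hr => (hφ r hr.1.le).mono (fun y hy => hr.1.le.trans (le_of_lt hy))) hint
      (fun r hr => by
        have hr0 := hr.1.le
        have hsq := Real.sqrt_pos.2 (hpos r)
        rw [real_inner_comm (u r) (u' r), hin r hr0, neg_le, le_div_iff₀ (by positivity)]
        have h1 : ‖u r‖ ≤ Real.sqrt (⟪u r, u r⟫ + ε ^ 2) := by
          apply Real.le_sqrt_of_sq_le
          rw [real_inner_self_eq_norm_sq]; nlinarith
        have h2 := neg_le_of_abs_le (abs_real_inner_le_norm (u r) (v r))
        nlinarith [norm_nonneg (v r), norm_nonneg (u r)])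
    have h0 : ‖u 0‖ ≤ Real.sqrt (⟪u 0, u 0⟫ + ε ^ 2) := by
      apply Real.le_sqrt_of_sq_le
      rw [real_inner_self_eq_norm_sq]; nlinarith
    have h1 : Real.sqrt (⟪u t, u t⟫ + ε ^ 2) ≤ ‖u t‖ + ε := by
      apply Real.sqrt_le_iff.2
      refine ⟨by positivity, ?_⟩
      rw [real_inner_self_eq_norm_sq]; nlinarith [norm_nonneg (u t)]
    simp only [φ] at this
    linarith
  apply le_of_forall_pos_le_add
  intro ε hε
  linarith [main ε hε]

lemma aux_opt (s p : ℝ) (hs0 : 0 < s) (hs1 : s < 1) (hp : 1 ≤ p) (α β : ℝ)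
    (hα : 0 < α) (hβ : 0 < β) : ∃ l : ℝ, 0 < l ∧
      l ^ (-((1 - s) * p)) * β = α ^ (1 - s) * β ^ s ∧ l ^ (s * p) * α = α ^ (1 - s) * β ^ s := by
  have hp0 : 0 < p := by linarith
  refine ⟨(β / α) ^ (1 / p), by positivity, ?_, ?_⟩
  · rw [← Real.rpow_mul (by positivity)]
    have : 1 / p * -((1 - s) * p) = s - 1 := by field_simp; ring
    rw [this, Real.div_rpow hβ.le hα.le, Real.rpow_sub_one hβ.ne', 
      show 1 - s = -(s-1) by ring, Real.rpow_neg hα.le]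
    field_simp
  · rw [← Real.rpow_mul (by positivity)]
    have : 1 / p * (s * p) = s := by field_simp
    rw [this, Real.div_rpow hβ.le hα.le, Real.rpow_sub hα, Real.rpow_one]
    field_simp

lemma aux_pt {F : Type*} [NormedAddCommGroup F] [InnerProductSpace ℝ F]
    (s p : ℝ) (hs0 : 0 < s) (hp : 1 ≤ p)
    (u u' v : ℝ → F) (h : ℝ → ℝ) (t : ℝ) (ht : 0 < t)
    (hu : ∀ r, 0 ≤ r → HasDerivWithinAt u (u' r) (Ici 0) r)
    (hv : ContinuousOn v (Ici 0))
    (hin : ∀ r, 0 ≤ r → ⟪u r, u' r⟫ = ⟪u r, v r⟫)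
    (hvh : ∀ r, 0 ≤ r → ‖v r‖ ≤ h r) :
    ENNReal.ofReal (‖u 0‖ ^ p) ≤ 2 ^ (p - 1) * (ENNReal.ofReal (‖u t‖ ^ p) +
      ENNReal.ofReal (s ^ (1 - p) * t ^ (s * p)) *
        ∫⁻ r in Ioi (0:ℝ), ENNReal.ofReal (h r ^ p / r ^ (1 - (1 - s) * p))) := by
  have hp0 : 0 < p := by linarith
  have hc : ContinuousOn (fun r => ‖v r‖) (Icc 0 t) := (hv.mono Icc_subset_Ici_self).norm
  have hint : IntegrableOn (fun r => ‖v r‖) (Ioc 0 t) :=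
    (hc.integrableOn_Icc (μ := volume)).mono_set Ioc_subset_Icc_self
  have h1 := aux_diamag u u' v t ht hu hv hin
  have h2 : ENNReal.ofReal ‖u 0‖ ≤ ENNReal.ofReal ‖u t‖
      + ∫⁻ r in Ioc 0 t, ENNReal.ofReal ‖v r‖ := by
    have h0 : 0 ≤ ∫ r in (0:ℝ)..t, ‖v r‖ :=
      intervalIntegral.integral_nonneg ht.le fun r _ => norm_nonneg _
    rw [← ofReal_integral_eq_lintegral_ofReal hint
        (ae_of_all _ fun r => norm_nonneg (v r)),
      ← intervalIntegral.integral_of_le ht.le, ← ENNReal.ofReal_add (norm_nonneg _) h0]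
    exact ENNReal.ofReal_le_ofReal h1
  rw [← ENNReal.ofReal_rpow_of_nonneg (norm_nonneg _) hp0.le,
    ← ENNReal.ofReal_rpow_of_nonneg (norm_nonneg _) hp0.le]
  calc _ ≤ (ENNReal.ofReal ‖u t‖ + ∫⁻ r in Ioc 0 t, ENNReal.ofReal ‖v r‖) ^ p := by gcongr
    _ ≤ 2 ^ (p - 1) * (ENNReal.ofReal ‖u t‖ ^ p + (∫⁻ r in Ioc 0 t, ENNReal.ofReal ‖v r‖) ^ p) :=
      ENNReal.rpow_add_le_mul_rpow_add_rpow _ _ hp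
    _ ≤ _ := by
      gcongr
      refine (aux_jensen s p t hs0 hp ht (fun r => ‖v r‖) (fun r => norm_nonneg _)
        hint.aestronglyMeasurable.aemeasurable).trans ?_
      refine mul_le_mul_right ?_ _
      refine le_trans ?_ (lintegral_mono_set (show Ioc (0:ℝ) t ⊆ Ioi 0 from Ioc_subset_Ioi_self))
      refine setLIntegral_mono' measurableSet_Ioc fun r hr => ?_
      have hr0 : 0 < r := hr.1
      apply ENNReal.ofReal_le_ofReal
      have := hvh r hr0.le
      gcongr

lemma aux_avg {F : Type*} [NormedAddCommGroup F] [InnerProductSpace ℝ F]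
    (s p : ℝ) (hs0 : 0 < s) (hs1 : s < 1) (hp : 1 ≤ p)
    (u u' v : ℝ → F) (h : ℝ → ℝ) (l : ℝ) (hl : 0 < l)
    (hu : ∀ r, 0 ≤ r → HasDerivWithinAt u (u' r) (Ici 0) r)
    (hv : ContinuousOn v (Ici 0))
    (hin : ∀ r, 0 ≤ r → ⟪u r, u' r⟫ = ⟪u r, v r⟫)
    (hvh : ∀ r, 0 ≤ r → ‖v r‖ ≤ h r) :
    ENNReal.ofReal (‖u 0‖ ^ p) ≤ 2 ^ (p - 1) *
      (ENNReal.ofReal (((1 - s) * p) * l ^ (-((1 - s) * p))) *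
        (∫⁻ r in Ioi (0:ℝ), ENNReal.ofReal (‖u r‖ ^ p / r ^ (1 - (1 - s) * p))) +
      ENNReal.ofReal (s ^ (1 - p) * l ^ (s * p)) *
        ∫⁻ r in Ioi (0:ℝ), ENNReal.ofReal (h r ^ p / r ^ (1 - (1 - s) * p))) := by
  have hp0 : 0 < p := by linarith
  have ha : 0 < (1 - s) * p := mul_pos (by linarith) hp0
  set a := (1 - s) * p with ha_def
  set G := ∫⁻ r in Ioi (0:ℝ), ENNReal.ofReal (h r ^ p / r ^ (1 - a)) with hG
  set H := ∫⁻ r in Ioi (0:ℝ), ENNReal.ofReal (‖u r‖ ^ p / r ^ (1 - a)) with hH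
  set c := ENNReal.ofReal (s ^ (1 - p) * l ^ (s * p)) with hc
  set X := ENNReal.ofReal (‖u 0‖ ^ p)
  have hW := aux_weight a l ha hl
  have hwm : Measurable (fun r : ℝ => ENNReal.ofReal (r ^ (a - 1))) := by fun_prop
  have step : X * ENNReal.ofReal (l ^ a / a) ≤ 2 ^ (p - 1) *
      (H + c * G * ENNReal.ofReal (l ^ a / a)) := by
    rw [← hW, ← lintegral_const_mul _ hwm, ← lintegral_const_mul _ hwm]
    calc _ ≤ ∫⁻ r in Ioc 0 l, 2 ^ (p - 1) * (ENNReal.ofReal (‖u r‖ ^ p / r ^ (1 - a)) +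
          c * G * ENNReal.ofReal (r ^ (a - 1))) := by
          refine setLIntegral_mono' measurableSet_Ioc fun r hr => ?_
          have hr0 : 0 < r := hr.1
          have e : ENNReal.ofReal (‖u r‖ ^ p / r ^ (1 - a)) =
              ENNReal.ofReal (‖u r‖ ^ p) * ENNReal.ofReal (r ^ (a - 1)) := by
            rw [← ENNReal.ofReal_mul (by positivity), div_eq_mul_inv, ← Real.rpow_neg hr0.le,
              neg_sub]
          rw [e, ← add_mul, ← mul_assoc]
          gcongr
          refine (aux_pt s p hs0 hp u u' v h r hr0 hu hv hin hvh).trans ?_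
          gcongr
          apply ENNReal.ofReal_le_ofReal
          gcongr
          exact hr.2
      _ = 2 ^ (p - 1) * ((∫⁻ r in Ioc 0 l, ENNReal.ofReal (‖u r‖ ^ p / r ^ (1 - a))) +
          ∫⁻ r in Ioc 0 l, c * G * ENNReal.ofReal (r ^ (a - 1))) := by
          rw [lintegral_const_mul' _ _ (by simp), lintegral_add_right _ (hwm.const_mul _)]
      _ ≤ _ := by
          gcongr
          exact lintegral_mono_set Ioc_subset_Ioi_self
  have hWi : ENNReal.ofReal (l ^ a / a) * ENNReal.ofReal (a * l ^ (-a)) = 1 := by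
    rw [← ENNReal.ofReal_mul (by positivity), Real.rpow_neg hl.le]
    have : l ^ a ≠ 0 := (Real.rpow_pos_of_pos hl a).ne'
    rw [show l ^ a / a * (a * (l ^ a)⁻¹) = 1 by field_simp]; simp
  calc X = X * ENNReal.ofReal (l ^ a / a) * ENNReal.ofReal (a * l ^ (-a)) := by
        rw [mul_assoc, hWi, mul_one]
    _ ≤ 2 ^ (p - 1) * (H + c * G * ENNReal.ofReal (l ^ a / a)) * ENNReal.ofReal (a * l ^ (-a)) := by
        gcongr
    _ = 2 ^ (p - 1) * (ENNReal.ofReal (a * l ^ (-a)) * H +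
        c * G * (ENNReal.ofReal (l ^ a / a) * ENNReal.ofReal (a * l ^ (-a)))) := by ring
    _ = _ := by rw [hWi, mul_one]

lemma emb_last {n : ℕ} (x : EuclideanSpace ℝ (Fin n)) (t : ℝ) : emb x t (Fin.last n) = t := by
  simp [emb]

lemma emb_mem {n : ℕ} (x : EuclideanSpace ℝ (Fin n)) (t : ℝ) (ht : 0 ≤ t) :
    emb x t ∈ closedHalfSpace n := by
  simpa [closedHalfSpace, emb_last] using ht

lemma emb_eq {n : ℕ} (x : EuclideanSpace ℝ (Fin n)) (t : ℝ) :
    emb x t = emb x 0 + t • EuclideanSpace.single (Fin.last n) (1:ℝ) := by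
  ext i
  refine Fin.lastCases ?_ (fun j => ?_) i
  · simp [emb]
  · simp [emb, (Fin.castSucc_lt_last j).ne]

lemma emb_hasDerivAt {n : ℕ} (x : EuclideanSpace ℝ (Fin n)) (t : ℝ) :
    HasDerivAt (emb x) (EuclideanSpace.single (Fin.last n) (1:ℝ)) t := by
  have : emb x = fun t : ℝ => emb x 0 + t • EuclideanSpace.single (Fin.last n) (1:ℝ) :=
    funext (emb_eq x)
  rw [this]
  simpa using ((hasDerivAt_id t).smul_const
    (EuclideanSpace.single (Fin.last n) (1:ℝ))).const_add (emb x 0)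

lemma emb_continuous {n : ℕ} :
    Continuous (fun q : EuclideanSpace ℝ (Fin n) × ℝ => emb q.1 q.2) := by
  unfold emb
  refine (EuclideanSpace.equiv (Fin (n + 1)) ℝ).symm.continuous.comp ?_
  refine continuous_pi fun i => ?_
  refine Fin.lastCases ?_ (fun j => ?_) i
  · simpa using continuous_snd
  · simp only [Fin.snoc_castSucc]
    exact (continuous_apply j).comp ((EuclideanSpace.equiv (Fin n) ℝ).continuous.comp continuous_fst)

lemma le_hsNorm {m : ℕ} {F : Type*} [NormedAddCommGroup F] [InnerProductSpace ℝ F]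
    (T : EuclideanSpace ℝ (Fin m) →L[ℝ] F) (i : Fin m) :
    ‖T (EuclideanSpace.single i (1:ℝ))‖ ≤ hsNorm T := by
  apply Real.le_sqrt_of_sq_le
  exact Finset.single_le_sum (f := fun i => ‖T (EuclideanSpace.single i (1 : ℝ))‖ ^ 2)
    (fun i _ => by positivity) (Finset.mem_univ i)

/-- Interpolation estimate for the `Lᵖ` norm of the trace:
`∫_{ℝⁿ} ‖U(·,0)‖ᵖ ≤ C (weighted energy of D_Γ U)^{1-s} (weighted energy of U)^{s}`. -/
theorem trace_Lp_interpolation_estimate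
    {F : Type*} [NormedAddCommGroup F] [InnerProductSpace ℝ F] [FiniteDimensional ℝ F]
    (n : ℕ) (hn : 1 ≤ n) (s p : ℝ) (hs0 : 0 < s) (hs1 : s < 1) (hp : 1 ≤ p) :
    ∃ C : ℝ, 0 < C ∧
      ∀ (Γ : EuclideanSpace ℝ (Fin (n + 1)) →
          EuclideanSpace ℝ (Fin (n + 1)) →L[ℝ] F →L[ℝ] F)
        (DΓ : EuclideanSpace ℝ (Fin (n + 1)) →
          EuclideanSpace ℝ (Fin (n + 1)) →L[ℝ] EuclideanSpace ℝ (Fin (n + 1)) →L[ℝ] F →L[ℝ] F),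
        -- Γ of class C¹ on the closed half-space, with skew-adjoint values
        (∀ z ∈ closedHalfSpace n, HasFDerivWithinAt Γ (DΓ z) (closedHalfSpace n) z) →
        ContinuousOn Γ (closedHalfSpace n) →
        ContinuousOn DΓ (closedHalfSpace n) →
        (∀ z ∈ closedHalfSpace n, ∀ (v : EuclideanSpace ℝ (Fin (n + 1))) (u w : F),
          ⟪(Γ z v) u, w⟫ = -⟪u, (Γ z v) w⟫) →
        -- U of class C¹ with compact support on the closed half-space
        ∀ (U : EuclideanSpace ℝ (Fin (n + 1)) → F)
          (DU : EuclideanSpace ℝ (Fin (n + 1)) → EuclideanSpace ℝ (Fin (n + 1)) →L[ℝ] F),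
        (∀ z ∈ closedHalfSpace n, HasFDerivWithinAt U (DU z) (closedHalfSpace n) z) →
        ContinuousOn DU (closedHalfSpace n) →
        HasCompactSupport U →
        (∫⁻ x : EuclideanSpace ℝ (Fin n), ENNReal.ofReal (‖U (emb x 0)‖ ^ p))
          ≤ ENNReal.ofReal C *
            (∫⁻ x : EuclideanSpace ℝ (Fin n), ∫⁻ t in Ioi (0:ℝ),
              ENNReal.ofReal
                (hsNorm (DU (emb x t) + (Γ (emb x t)).flip (U (emb x t))) ^ p
                  / t ^ (1 - (1 - s) * p))) ^ (1 - s) *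
            (∫⁻ x : EuclideanSpace ℝ (Fin n), ∫⁻ t in Ioi (0:ℝ),
              ENNReal.ofReal (‖U (emb x t)‖ ^ p / t ^ (1 - (1 - s) * p))) ^ s := by
  have hp0 : 0 < p := by linarith
  have ha : 0 < (1 - s) * p := mul_pos (by linarith) hp0
  refine ⟨2 ^ (p - 1) * ((1 - s) * p + s ^ (1 - p)), by positivity, ?_⟩
  intro Γ DΓ hΓ' hΓ _ hskew U DU hU hDU hsupp
  have hUc : ContinuousOn U (closedHalfSpace n) := fun z hz => (hU z hz).continuousWithinAt
  let e : EuclideanSpace ℝ (Fin (n + 1)) := EuclideanSpace.single (Fin.last n) (1:ℝ)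
  let T : EuclideanSpace ℝ (Fin n) → ℝ → EuclideanSpace ℝ (Fin (n + 1)) →L[ℝ] F :=
    fun x t => DU (emb x t) + (Γ (emb x t)).flip (U (emb x t))
  have hmaps : ∀ x : EuclideanSpace ℝ (Fin n), MapsTo (emb x) (Ici 0) (closedHalfSpace n) :=
    fun x t ht => emb_mem x t ht
  have hembc : ∀ x : EuclideanSpace ℝ (Fin n), Continuous (emb x) := fun x =>
    emb_continuous.comp (Continuous.prodMk_right x)
  have hu : ∀ x, ∀ r, 0 ≤ r →
      HasDerivWithinAt (fun t => U (emb x t)) (DU (emb x r) e) (Ici 0) r := fun x r hr =>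
    (hU _ (emb_mem x r hr)).comp_hasDerivWithinAt r (emb_hasDerivAt x r).hasDerivWithinAt (hmaps x)
  have hv : ∀ x, ContinuousOn (fun t => T x t e) (Ici 0) := by
    intro x
    have h1 : ContinuousOn (fun t => DU (emb x t)) (Ici 0) :=
      hDU.comp (hembc x).continuousOn (hmaps x)
    have h2 : ContinuousOn (fun t => Γ (emb x t)) (Ici 0) :=
      hΓ.comp (hembc x).continuousOn (hmaps x)
    have h3 : ContinuousOn (fun t => U (emb x t)) (Ici 0) :=
      hUc.comp (hembc x).continuousOn (hmaps x)
    have h4 : ContinuousOn (fun t => DU (emb x t) e + (Γ (emb x t) e) (U (emb x t))) (Ici 0) :=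
      (h1.clm_apply continuousOn_const).add ((h2.clm_apply continuousOn_const).clm_apply h3)
    exact h4
  have hin : ∀ x, ∀ r, 0 ≤ r →
      ⟪U (emb x r), DU (emb x r) e⟫ = ⟪U (emb x r), T x r e⟫ := by
    intro x r hr
    have h1 := hskew _ (emb_mem x r hr) e (U (emb x r)) (U (emb x r))
    rw [real_inner_comm] at h1
    have h2 : ⟪U (emb x r), Γ (emb x r) e (U (emb x r))⟫ = 0 := by linarith
    simp only [T, add_apply, ContinuousLinearMap.flip_apply, inner_add_right,
      h2, add_zero]
  have hvh : ∀ x, ∀ r, 0 ≤ r → ‖T x r e‖ ≤ hsNorm (T x r) := fun x r _ => le_hsNorm _ _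
  set G : EuclideanSpace ℝ (Fin n) → ℝ≥0∞ := fun x => ∫⁻ t in Ioi (0:ℝ),
    ENNReal.ofReal (hsNorm (T x t) ^ p / t ^ (1 - (1 - s) * p)) with hG
  set H : EuclideanSpace ℝ (Fin n) → ℝ≥0∞ := fun x => ∫⁻ t in Ioi (0:ℝ),
    ENNReal.ofReal (‖U (emb x t)‖ ^ p / t ^ (1 - (1 - s) * p)) with hH
  change _ ≤ _ * (∫⁻ x, G x) ^ (1 - s) * (∫⁻ x, H x) ^ s
  have hpt : ∀ x t, 0 < t → ENNReal.ofReal (‖U (emb x 0)‖ ^ p) ≤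
      2 ^ (p - 1) * (ENNReal.ofReal (‖U (emb x t)‖ ^ p) +
      ENNReal.ofReal (s ^ (1 - p) * t ^ (s * p)) * G x) := fun x t ht =>
    aux_pt s p hs0 hp (fun t => U (emb x t)) (fun t => DU (emb x t) e) (fun t => T x t e)
      (fun t => hsNorm (T x t)) t ht (hu x) (hv x) (hin x) (hvh x)
  have havg : ∀ x l, 0 < l → ENNReal.ofReal (‖U (emb x 0)‖ ^ p) ≤
      2 ^ (p - 1) * (ENNReal.ofReal (((1 - s) * p) * l ^ (-((1 - s) * p))) * H x +
      ENNReal.ofReal (s ^ (1 - p) * l ^ (s * p)) * G x) := fun x l hl =>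
    aux_avg s p hs0 hs1 hp (fun t => U (emb x t)) (fun t => DU (emb x t) e) (fun t => T x t e)
      (fun t => hsNorm (T x t)) l hl (hu x) (hv x) (hin x) (hvh x)
  -- measurability of H
  have hHm : Measurable H := by
    have hcont : Continuous (fun q : EuclideanSpace ℝ (Fin n) × ℝ => U (emb q.1 (max q.2 0))) := by
      have h1 : Continuous (fun q : EuclideanSpace ℝ (Fin n) × ℝ => emb q.1 (max q.2 0)) :=
        emb_continuous.comp (continuous_fst.prodMk (continuous_snd.max continuous_const))
      exact hUc.comp_continuous h1 fun q => emb_mem _ _ (le_max_right _ _)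
    have hm : Measurable (fun q : EuclideanSpace ℝ (Fin n) × ℝ =>
        ENNReal.ofReal (‖U (emb q.1 (max q.2 0))‖ ^ p / q.2 ^ (1 - (1 - s) * p))) := by
      have := hcont.norm.measurable
      fun_prop
    have h2 := hm.lintegral_prod_right' (ν := volume.restrict (Ioi (0:ℝ)))
    convert h2 using 2 with x
    refine setLIntegral_congr_fun measurableSet_Ioi fun t ht => ?_
    simp only [max_eq_left (le_of_lt (mem_Ioi.1 ht))]
  -- vanishing of the energy of `U`
  by_cases hB0 : ∫⁻ x, H x = 0
  · have hz : ∀ᵐ x, ENNReal.ofReal (‖U (emb x 0)‖ ^ p) = 0 := by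
      filter_upwards [(lintegral_eq_zero_iff hHm).1 hB0] with x hx
      have hcx : ContinuousOn (fun t => U (emb x t)) (Ici 0) :=
        hUc.comp (hembc x).continuousOn (hmaps x)
      have hmx : AEMeasurable (fun t : ℝ => ENNReal.ofReal (‖U (emb x t)‖ ^ p / t ^ (1 - (1 - s) * p)))
          (volume.restrict (Ioi 0)) := by
        have : AEMeasurable (fun t => ‖U (emb x t)‖) (volume.restrict (Ioi 0)) :=
          (hcx.mono Ioi_subset_Ici_self).norm.aemeasurable measurableSet_Ioi
        fun_prop
      have h1 := (lintegral_eq_zero_iff' hmx).1 hx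
      have h2 : (fun t => U (emb x t)) =ᵐ[volume.restrict (Ici 0)] (fun _ => 0) := by
        rw [← Measure.restrict_congr_set Ioi_ae_eq_Ici]
        filter_upwards [h1, ae_restrict_mem measurableSet_Ioi] with t ht ht0
        have ht0' : (0:ℝ) < t := ht0
        by_contra hne
        have : 0 < ‖U (emb x t)‖ ^ p / t ^ (1 - (1 - s) * p) := by
          have := norm_pos_iff.2 hne
          positivity
        simp only [Pi.zero_apply, ENNReal.ofReal_eq_zero] at ht
        linarith
      have h3 := Measure.eqOn_of_ae_eq h2 hcx continuousOn_const
        (by rw [interior_Ici, closure_Ioi])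
      have h4 : U (emb x 0) = 0 := h3 self_mem_Ici
      simp [h4, Real.zero_rpow hp0.ne']
    rw [lintegral_congr_ae hz]; simp
  have havgI : ∀ l, 0 < l → ∫⁻ x : EuclideanSpace ℝ (Fin n), ENNReal.ofReal (‖U (emb x 0)‖ ^ p) ≤
      2 ^ (p - 1) * (ENNReal.ofReal (((1 - s) * p) * l ^ (-((1 - s) * p))) * (∫⁻ x, H x) +
      ENNReal.ofReal (s ^ (1 - p) * l ^ (s * p)) * ∫⁻ x, G x) := by
    intro l hl
    refine (lintegral_mono fun x => havg x l hl).trans ?_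
    rw [lintegral_const_mul' _ _ (by simp), lintegral_add_left (hHm.const_mul _),
      lintegral_const_mul' _ _ ENNReal.ofReal_ne_top, lintegral_const_mul' _ _ ENNReal.ofReal_ne_top]
  obtain ⟨R, hR0, hR⟩ : ∃ t : ℝ, 0 < t ∧ ∀ x : EuclideanSpace ℝ (Fin n), U (emb x t) = 0 := by
    obtain ⟨R, hR⟩ := hsupp.isBounded.exists_norm_le
    refine ⟨|R| + 1, by positivity, fun x => ?_⟩
    by_contra hne
    have h1 := hR _ (subset_tsupport U hne)
    have h2 := PiLp.norm_apply_le (emb x (|R| + 1)) (Fin.last n)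
    rw [emb_last, Real.norm_eq_abs, abs_of_pos (by positivity)] at h2
    linarith [le_abs_self R]
  have hs1' : 0 < 1 - s := by linarith
  by_cases hA0 : ∫⁻ x, G x = 0
  · refine (lintegral_mono fun x => hpt x R hR0).trans ?_
    simp only [hR, norm_zero, Real.zero_rpow hp0.ne', ENNReal.ofReal_zero, zero_add]
    rw [lintegral_const_mul' _ _ (by simp), lintegral_const_mul' _ _ ENNReal.ofReal_ne_top, hA0]
    simp
  by_cases hAt : ∫⁻ x, G x = ⊤
  · rw [hAt, ENNReal.top_rpow_of_pos hs1', ENNReal.mul_top (by simp; positivity), ENNReal.top_mul]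
    · exact le_top
    · simp [hB0, hs0.not_gt]
  by_cases hBt : ∫⁻ x, H x = ⊤
  · rw [hBt, ENNReal.top_rpow_of_pos hs0, ENNReal.mul_top]
    · exact le_top
    · refine mul_ne_zero (by simp; positivity) ?_
      simp [hA0, hs1.not_gt]
  have hα := ENNReal.toReal_pos hA0 hAt
  have hβ := ENNReal.toReal_pos hB0 hBt
  obtain ⟨l, hl, e1, e2⟩ := aux_opt s p hs0 hs1 hp _ _ hα hβ
  refine (havgI l hl).trans (le_of_eq ?_)
  rw [← ENNReal.ofReal_toReal hAt, ← ENNReal.ofReal_toReal hBt]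
  set α := (∫⁻ x, G x).toReal
  set β := (∫⁻ x, H x).toReal
  have h2 : (2:ℝ≥0∞) ^ (p - 1) = ENNReal.ofReal (2 ^ (p - 1)) := by
    rw [← ENNReal.ofReal_rpow_of_pos (by norm_num)]; simp
  rw [h2, ENNReal.ofReal_rpow_of_pos hα, ENNReal.ofReal_rpow_of_pos hβ,
    ← ENNReal.ofReal_mul (by positivity), ← ENNReal.ofReal_mul (by positivity),
    ← ENNReal.ofReal_add (by positivity) (by positivity), ← ENNReal.ofReal_mul (by positivity),
    ← ENNReal.ofReal_mul (by positivity), ← ENNReal.ofReal_mul (by positivity)]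
  congr 1
  linear_combination 2 ^ (p - 1) * (1 - s) * p * e1 + 2 ^ (p - 1) * s ^ (1 - p) * e2
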